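/- arXiv:1604.01993 — 2 statements merged into one kernel-verified Lean document; each statement's English description precedes it below -/
import Mathlib

section
/- A Busemann convex complete geodesic metric space satisfies the symmetric orthogonality property (SO) if and only if it satisfies the non-expansive projection property (NE). -/
open Set Metric Filter

variable {M : Type*}

def IsGeodesic [MetricSpace M] (γ : ℝ → M) : Prop :=
  ∀ s ∈ Set.Icc (0:ℝ) 1, ∀ t ∈ Set.Icc (0:ℝ) 1,
    dist (γ s) (γ t) = |s - t| * dist (γ 0) (γ 1)

def GeodesicSpace (M : Type*) [MetricSpace M] : Prop :=
  ∀ x y : M, ∃ γ : ℝ → M, IsGeodesic γ ∧ γ 0 = x ∧ γ 1 = y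

def Perp [MetricSpace M] (γ η : ℝ → M) : Prop :=
  ∀ t ∈ Set.Icc (0:ℝ) 1, ∀ s ∈ Set.Icc (0:ℝ) 1,
    dist (γ 0) (γ t) ≤ dist (η s) (γ t)

def SO (M : Type*) [MetricSpace M] : Prop :=
  ∀ γ η : ℝ → M, IsGeodesic γ → IsGeodesic η → γ 0 = η 0 → Perp γ η → Perp η γ

def WeaklyConvex [MetricSpace M] (C : Set M) : Prop :=
  ∀ x ∈ C, ∀ y ∈ C, ∃ γ : ℝ → M, IsGeodesic γ ∧ γ 0 = x ∧ γ 1 = y ∧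
    ∀ t ∈ Set.Icc (0:ℝ) 1, γ t ∈ C

def GeoConvex [MetricSpace M] (C : Set M) : Prop :=
  ∀ γ : ℝ → M, IsGeodesic γ → γ 0 ∈ C → γ 1 ∈ C → ∀ t ∈ Set.Icc (0:ℝ) 1, γ t ∈ C

def NearestPt [MetricSpace M] (C : Set M) (x y : M) : Prop :=
  y ∈ C ∧ dist x y = Metric.infDist x C

def NE (M : Type*) [MetricSpace M] : Prop :=
  ∀ C : Set M, IsClosed C → WeaklyConvex C → ∀ x y xC yC : M,
    NearestPt C x xC → NearestPt C y yC → dist xC yC ≤ dist x y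

def BusemannConvex (M : Type*) [MetricSpace M] : Prop :=
  ∀ γ η : ℝ → M, IsGeodesic γ → IsGeodesic η →
    ConvexOn ℝ (Set.Icc (0:ℝ) 1) (fun t => dist (γ t) (η t))

section GeodesicLemmas

variable [MetricSpace M]

/-- The image of a geodesic under an affine reparametrization is a geodesic. -/
lemma IsGeodesic.reparam {γ : ℝ → M} (hγ : IsGeodesic γ) {u v : ℝ}
    (hu : u ∈ Icc (0:ℝ) 1) (hv : v ∈ Icc (0:ℝ) 1) :
    IsGeodesic (fun r => γ (u + r * (v - u))) := by
  have mem : ∀ r ∈ Icc (0:ℝ) 1, u + r * (v - u) ∈ Icc (0:ℝ) 1 := by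
    rintro r ⟨h0, h1⟩
    obtain ⟨hu0, hu1⟩ := hu
    obtain ⟨hv0, hv1⟩ := hv
    constructor <;> nlinarith
  intro s hs t ht
  have h0 : u + 0 * (v - u) = u := by ring
  have h1 : u + 1 * (v - u) = v := by ring
  have h2 : u + s * (v - u) - (u + t * (v - u)) = (s - t) * (v - u) := by ring
  simp only [h0, h1]
  rw [hγ _ (mem s hs) _ (mem t ht), hγ u hu v hv, h2, abs_mul, abs_sub_comm v u]
  ring

lemma IsGeodesic.dist_of_le {γ : ℝ → M} (hγ : IsGeodesic γ) {s t : ℝ}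
    (hs : 0 ≤ s) (hst : s ≤ t) (ht : t ≤ 1) :
    dist (γ s) (γ t) = (t - s) * dist (γ 0) (γ 1) := by
  rw [hγ s ⟨hs, hst.trans ht⟩ t ⟨hs.trans hst, ht⟩, abs_sub_comm, abs_of_nonneg (by linarith)]

lemma BusemannConvex.dist_le (hB : BusemannConvex M) {γ η : ℝ → M} (hγ : IsGeodesic γ)
    (hη : IsGeodesic η) {t : ℝ} (ht : t ∈ Icc (0:ℝ) 1) :
    dist (γ t) (η t) ≤ (1 - t) * dist (γ 0) (η 0) + t * dist (γ 1) (η 1) := by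
  have h := (hB γ η hγ hη).2 (left_mem_Icc.2 zero_le_one) (right_mem_Icc.2 zero_le_one)
    (sub_nonneg.2 ht.2) ht.1 (by ring)
  simpa using h

/-- A midpoint of two points lies on a geodesic between them. -/
lemma exists_isGeodesic_of_midpoint (hgeo : GeodesicSpace M) {x u y : M} {R : ℝ}
    (hxu : dist x u = R) (huy : dist u y = R) (hxy : dist x y = 2 * R) :
    ∃ γ : ℝ → M, IsGeodesic γ ∧ γ 0 = x ∧ γ 1 = y ∧ γ (1 / 2) = u := by
  obtain ⟨p, hp, hp0, hp1⟩ := hgeo x u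
  obtain ⟨q, hq, hq0, hq1⟩ := hgeo u y
  set γ : ℝ → M := fun t => if t ≤ 1 / 2 then p (2 * t) else q (2 * t - 1) with hγ
  have h0 : γ 0 = x := by simp [hγ, hp0]
  have h1 : γ 1 = y := by
    have : ¬ (1:ℝ) ≤ 1 / 2 := by norm_num
    simp only [hγ, this, if_false]
    norm_num [hq1]
  have hhalf : γ (1 / 2) = u := by simp [hγ, hp1]
  have key : ∀ s t : ℝ, 0 ≤ s → s ≤ t → t ≤ 1 → dist (γ s) (γ t) = (t - s) * (2 * R) := by
    intro s t hs hst ht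
    by_cases ht2 : t ≤ 1 / 2
    · have hs2 : s ≤ 1 / 2 := hst.trans ht2
      simp only [hγ, hs2, ht2, if_true]
      rw [hp.dist_of_le (by linarith) (by linarith) (by linarith), hp0, hp1, hxu]
      ring
    by_cases hs2 : s ≤ 1 / 2
    · simp only [hγ, hs2, ht2, if_true, if_false]
      push Not at ht2
      have e1 := hp.dist_of_le (le_refl 0) (show 0 ≤ 2 * s by linarith) (by linarith)
      have e2 := hp.dist_of_le (show 0 ≤ 2 * s by linarith) (by linarith) le_rfl
      have e3 := hq.dist_of_le (le_refl 0) (show 0 ≤ 2 * t - 1 by linarith) (by linarith)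
      have e4 := hq.dist_of_le (show 0 ≤ 2 * t - 1 by linarith) (by linarith) le_rfl
      rw [hp0, hp1, hxu] at e1 e2
      rw [hq0, hq1, huy] at e3 e4
      have t1 := dist_triangle (p (2 * s)) u (q (2 * t - 1))
      have t2 := dist_triangle4 x (p (2 * s)) (q (2 * t - 1)) y
      apply le_antisymm <;> linarith
    · simp only [hγ, hs2, ht2, if_false]
      push Not at hs2
      rw [hq.dist_of_le (by linarith) (by linarith) (by linarith), hq0, hq1, huy]
      ring
  refine ⟨γ, ?_, h0, h1, hhalf⟩
  intro s hs t ht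
  rw [h0, h1, hxy]
  rcases le_total s t with h | h
  · rw [key s t hs.1 h ht.2, abs_sub_comm, abs_of_nonneg (sub_nonneg.2 h)]
  · rw [dist_comm, key t s ht.1 h hs.2, abs_of_nonneg (sub_nonneg.2 h)]

lemma BusemannConvex.midpoint_unique (hgeo : GeodesicSpace M) (hB : BusemannConvex M)
    {x u v y : M} {R : ℝ} (hxu : dist x u = R) (huy : dist u y = R) (hxv : dist x v = R)
    (hvy : dist v y = R) (hxy : dist x y = 2 * R) : u = v := by
  obtain ⟨γ, hγ, hγ0, hγ1, rfl⟩ := exists_isGeodesic_of_midpoint hgeo hxu huy hxy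
  obtain ⟨η, hη, hη0, hη1, rfl⟩ := exists_isGeodesic_of_midpoint hgeo hxv hvy hxy
  have h := hB.dist_le hγ hη (t := 1 / 2) ⟨by norm_num, by norm_num⟩
  rw [hγ0, hγ1, hη0, hη1, dist_self, dist_self] at h
  exact dist_le_zero.1 (by linarith)

/-- Balls in a Busemann convex space are strictly convex. -/
lemma BusemannConvex.eq_of_dist_eq (hgeo : GeodesicSpace M) (hB : BusemannConvex M)
    {η : ℝ → M} (hη : IsGeodesic η) {x : M} (heq : dist x (η 0) = dist x (η 1))
    (hmid : dist x (η 0) ≤ dist x (η (1 / 2))) : η 0 = η 1 := by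
  have hhalf : (1 / 2 : ℝ) ∈ Icc (0:ℝ) 1 := ⟨by norm_num, by norm_num⟩
  have key : ∀ (k : ℕ) (x : M), dist x (η 0) = dist x (η 1) →
      dist x (η 0) ≤ dist x (η (1 / 2)) →
      dist (η 0) (η 1) ≤ 2 * dist x (η 0) * (1 / 2) ^ k := by
    intro k
    induction k with
    | zero =>
      intro x hx _
      have := dist_triangle_left (η 0) (η 1) x
      simp only [pow_zero]
      linarith
    | succ k ih =>
      intro x hx hm
      obtain ⟨α, hα, hα0, hα1⟩ := hgeo (η 0) x
      obtain ⟨β, hβ, hβ0, hβ1⟩ := hgeo (η 1) x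
      have hrev := hη.reparam (right_mem_Icc.2 zero_le_one) (left_mem_Icc.2 zero_le_one)
      have hu := hB.dist_le hα hη hhalf
      have hv := hB.dist_le hβ hrev hhalf
      norm_num [hα0, hα1, hβ0, hβ1] at hu hv
      have a1 := hα.dist_of_le (le_refl 0) (show (0:ℝ) ≤ 1 / 2 by norm_num) (by norm_num)
      have a2 := hα.dist_of_le (show (0:ℝ) ≤ 1 / 2 by norm_num) (by norm_num) (le_refl 1)
      have b1 := hβ.dist_of_le (le_refl 0) (show (0:ℝ) ≤ 1 / 2 by norm_num) (by norm_num)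
      have b2 := hβ.dist_of_le (show (0:ℝ) ≤ 1 / 2 by norm_num) (by norm_num) (le_refl 1)
      norm_num [hα0, hα1, hβ0, hβ1] at a1 a2 b1 b2 hm
      rw [dist_comm _ x, dist_comm _ x] at a2 b2
      rw [dist_comm _ (α (1 / 2)), dist_comm _ x] at a1
      rw [dist_comm _ (β (1 / 2)), dist_comm _ x] at b1
      have t1 := dist_triangle x (α (1 / 2)) (η (1 / 2))
      have t2 := dist_triangle x (β (1 / 2)) (η (1 / 2))
      have huv : α (1 / 2) = β (1 / 2) := by
        refine hB.midpoint_unique hgeo (x := x) (y := η (1 / 2))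
          (R := dist x (η 0) / 2) ?_ ?_ ?_ ?_ ?_ <;> linarith
      have := ih (α (1 / 2)) (by rw [a1, huv, b1, hx]) (by linarith)
      rw [a1] at this
      rw [pow_succ]
      linarith
  have hlim : Tendsto (fun k : ℕ => 2 * dist x (η 0) * (1 / 2 : ℝ) ^ k) atTop (nhds 0) := by
    simpa using (tendsto_pow_atTop_nhds_zero_of_lt_one (by norm_num : (0:ℝ) ≤ 1 / 2)
      (by norm_num)).const_mul (2 * dist x (η 0))
  exact dist_le_zero.1 (ge_of_tendsto' hlim fun k => key k x heq hmid)

lemma NearestPt.dist_le {C : Set M} {x p : M} (h : NearestPt C x p) {q : M} (hq : q ∈ C) :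
    dist x p ≤ dist x q :=
  h.2.trans_le (infDist_le_dist_of_mem hq)

/-- Along the geodesic from a nearest point `γ 0` to `γ 1`, the nearest point does not change. -/
lemma IsGeodesic.dist_le_of_nearest {γ : ℝ → M} (hγ : IsGeodesic γ) {q : M}
    (h : dist (γ 1) (γ 0) ≤ dist (γ 1) q) {t : ℝ} (ht : t ∈ Icc (0:ℝ) 1) :
    dist (γ 0) (γ t) ≤ dist q (γ t) := by
  have h1 := hγ.dist_of_le le_rfl ht.1 ht.2
  have h2 := hγ.dist_of_le ht.1 ht.2 le_rfl
  have h3 := dist_triangle_left (γ 1) q (γ t)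
  rw [dist_comm (γ 1) (γ 0), dist_comm (γ 1) q] at h
  rw [dist_comm (γ t) q, dist_comm (γ 1) q] at h3
  linarith

lemma NE.symmetricOrthogonality (hNE : NE M) : SO M := by
  intro γ η hγ hη h0 hperp s hs t ht
  set C : Set M := η '' Icc (0:ℝ) 1 with hC
  have hlip : LipschitzOnWith (nndist (η 0) (η 1)) η (Icc (0:ℝ) 1) :=
    LipschitzOnWith.of_dist_le_mul fun a ha b hb => by
      rw [hη a ha b hb, Real.dist_eq, coe_nndist, mul_comm]
  have hclosed : IsClosed C := (isCompact_Icc.image_of_continuousOn hlip.continuousOn).isClosed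
  have hconv : WeaklyConvex C := by
    rintro _ ⟨u, hu, rfl⟩ _ ⟨v, hv, rfl⟩
    refine ⟨_, hη.reparam hu hv, by simp, by simp, ?_⟩
    rintro r ⟨hr0, hr1⟩
    refine ⟨_, ?_, rfl⟩
    obtain ⟨hu0, hu1⟩ := hu
    obtain ⟨hv0, hv1⟩ := hv
    constructor <;> nlinarith
  have hmem : ∀ r ∈ Icc (0:ℝ) 1, η r ∈ C := fun r hr => ⟨r, hr, rfl⟩
  have hp : NearestPt C (γ t) (η 0) := by
    refine ⟨hmem 0 (left_mem_Icc.2 zero_le_one), le_antisymm ?_ ?_⟩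
    · rw [le_infDist ⟨_, hmem s hs⟩]
      rintro _ ⟨r, hr, rfl⟩
      rw [← h0, dist_comm, dist_comm (γ t)]
      exact hperp t ht r hr
    · exact infDist_le_dist_of_mem (hmem 0 (left_mem_Icc.2 zero_le_one))
  have hq : NearestPt C (η s) (η s) :=
    ⟨hmem s hs, by rw [dist_self, infDist_zero_of_mem (hmem s hs)]⟩
  exact hNE C hclosed hconv _ _ _ _ hp hq

lemma SO.nonexpansiveProjection (hgeo : GeodesicSpace M) (hB : BusemannConvex M) (hSO : SO M) :
    NE M := by
  intro C _ hC x y a b ha hb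
  by_contra! hlt
  obtain ⟨η, hη, hη0, hη1, hηC⟩ := hC a ha.1 b hb.1
  have hL : 0 < dist a b := dist_nonneg.trans_lt hlt
  -- the point `η θ` lies at distance `dist x y` from `b`
  set θ : ℝ := 1 - dist x y / dist a b with hθ
  have hθ0 : 0 < θ := by rw [hθ, sub_pos, div_lt_one hL]; exact hlt
  have hθ1 : θ ≤ 1 := by rw [hθ]; linarith [div_nonneg (dist_nonneg (x := x) (y := y)) hL.le]
  have hθL : (1 - θ) * dist a b = dist x y := by rw [hθ]; field_simp; ring
  have hθm : θ ∈ Icc (0:ℝ) 1 := ⟨hθ0.le, hθ1⟩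
  have h0m : (0:ℝ) ∈ Icc (0:ℝ) 1 := left_mem_Icc.2 zero_le_one
  have h1m : (1:ℝ) ∈ Icc (0:ℝ) 1 := right_mem_Icc.2 zero_le_one
  obtain ⟨γ, hγ, hγ0, hγ1⟩ := hgeo b y
  obtain ⟨ν, hν, hν0, hν1⟩ := hgeo (η θ) x
  have hb_perp : Perp (fun r => η (1 + r * (0 - 1))) γ := by
    refine hSO γ _ hγ (hη.reparam h1m h0m) (by simp [hγ0, hη1]) fun t ht s hs => ?_
    refine hγ.dist_le_of_nearest ?_ ht
    rw [hγ0, hγ1]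
    exact hb.dist_le (hηC _ ⟨by linarith [hs.2], by linarith [hs.1]⟩)
  have hc_perp : Perp (fun r => η (θ + r * (0 - θ))) ν := by
    intro r hr t ht
    set w : ℝ := θ + r * (0 - θ) with hw
    have hw0 : 0 ≤ w := by nlinarith [hr.2]
    have hwθ : w ≤ θ := by nlinarith [hr.1]
    have h1 := hb_perp (1 - w) ⟨by linarith, by linarith⟩ t ht
    have h2 := hB.dist_le hν hγ ht
    have h3 := hη.dist_of_le hθ0.le hθ1 le_rfl
    have h4 := hη.dist_of_le hw0 hwθ hθ1
    have h5 := hη.dist_of_le hw0 (hwθ.trans hθ1) le_rfl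
    have h6 := dist_triangle_left (γ t) (η w) (ν t)
    have e1 : (1:ℝ) + (1 - w) * (0 - 1) = w := by ring
    have e2 : θ + 0 * (0 - θ) = θ := by ring
    have e3 : (1:ℝ) + 0 * (0 - 1) = 1 := by ring
    simp only [e1, e3] at h1
    simp only [e2]
    rw [hη0, hη1] at h3 h4 h5
    rw [hη1, dist_comm b] at h1
    rw [hν0, hν1, hγ0, hγ1, h3, hθL] at h2
    rw [dist_comm (η θ)]
    linarith
  have hle := hSO _ _ (hη.reparam hθm h0m) hν (by simp [hν0]) hc_perp 1 h1m 1 h1m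
  have hsub := hη.reparam h0m hθm
  have hax : dist x a = dist x (η θ) := by
    refine le_antisymm (ha.dist_le (hηC θ hθm)) ?_
    simpa [hν0, hν1, hη0, dist_comm] using hle
  have hac := hB.eq_of_dist_eq hgeo hsub (x := x) (by simpa [hη0] using hax) (by
    have := ha.dist_le (hηC (0 + 1 / 2 * (θ - 0)) ⟨by linarith, by linarith⟩)
    simpa [hη0] using this)
  have hd := hη.dist_of_le le_rfl hθ0.le hθ1
  have hac' : η 0 = η θ := by simpa using hac
  rw [hac', dist_self, ← hac', hη0, hη1] at hd
  nlinarith [mul_pos hθ0 hL]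

end GeodesicLemmas

theorem stmt5 [MetricSpace M] [CompleteSpace M] (hgeo : GeodesicSpace M)
    (hB : BusemannConvex M) : SO M ↔ NE M := by
  exact ⟨SO.nonexpansiveProjection hgeo hB, NE.symmetricOrthogonality⟩
end

section
/- A normed vector space (ℝⁿ, ‖·‖) with n ≥ 3 satisfies the symmetric orthogonality property (SO) if and only if the norm is induced by an inner product. -/
/-- Birkhoff orthogonality (segment convention): v ⟂_B w iff
‖v‖ ≤ ‖v + s • w‖ for all s ≥ 0. -/
def BPerp {E : Type*} [NormedAddCommGroup E] [NormedSpace ℝ E] (v w : E) : Prop :=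
  ∀ s : ℝ, 0 ≤ s → ‖v‖ ≤ ‖v + s • w‖


open Filter Topology

section BirkhoffJames

variable {E : Type*} [NormedAddCommGroup E] [NormedSpace ℝ E]

/-- Two-sided Birkhoff–James orthogonality. -/
def BJPerp (v w : E) : Prop := ∀ s : ℝ, ‖v‖ ≤ ‖v + s • w‖

theorem bjPerp_iff_bPerp {v w : E} : BJPerp v w ↔ BPerp v w ∧ BPerp v (-w) := by
  refine ⟨fun h => ⟨fun s _ => h s, fun s _ => ?_⟩, fun ⟨h, h'⟩ s => ?_⟩
  · simpa using h (-s)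
  · rcases le_total 0 s with hs | hs
    · exact h s hs
    · simpa using h' (-s) (by linarith)

theorem BPerp.neg_neg {v w : E} (h : BPerp v w) : BPerp (-v) (-w) := by
  intro s hs
  have := h s hs
  rwa [smul_neg, ← neg_add, norm_neg, norm_neg]

theorem bjPerp_symm (hsymm : ∀ v w : E, BPerp v w → BPerp w v) {v w : E} (h : BJPerp v w) :
    BJPerp w v := by
  rw [bjPerp_iff_bPerp] at h ⊢
  refine ⟨hsymm _ _ h.1, ?_⟩
  simpa using (hsymm _ _ h.2).neg_neg

theorem convexOn_norm_line (v w : E) : ConvexOn ℝ Set.univ (fun s : ℝ => ‖v + s • w‖) := by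
  refine ⟨convex_univ, fun a _ b _ p q hp hq hpq => ?_⟩
  have : v + (p • a + q • b) • w = p • (v + a • w) + q • (v + b • w) := by
    have : v = (p + q) • v := by rw [hpq, one_smul]
    nth_rewrite 1 [this]
    simp only [smul_eq_mul]
    module
  simp only [this]
  refine (norm_add_le _ _).trans ?_
  rw [norm_smul_of_nonneg hp, norm_smul_of_nonneg hq]
  rfl

theorem bjPerp_of_eventually {v w : E} (h : ∀ᶠ s : ℝ in 𝓝 0, ‖v‖ ≤ ‖v + s • w‖) : BJPerp v w := by
  have hmin : IsLocalMin (fun s : ℝ => ‖v + s • w‖) 0 := by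
    filter_upwards [h] with s hs
    simpa using hs
  intro s
  simpa using IsMinOn.of_isLocalMin_of_convex_univ hmin (convexOn_norm_line v w) s

theorem bjPerp_of_dual {v w : E} (f : StrongDual ℝ E) (hf : ‖f‖ ≤ 1) (hv : f v = ‖v‖)
    (hw : f w = 0) : BJPerp v w := by
  intro s
  calc ‖v‖ = f (v + s • w) := by simp [hv, hw]
    _ ≤ ‖f (v + s • w)‖ := le_abs_self _
    _ ≤ ‖v + s • w‖ := f.le_of_opNorm_le_of_le hf le_rfl |>.trans (by simp)

theorem BJPerp.exists_dual {v w : E} (h : BJPerp v w) :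
    ∃ f : StrongDual ℝ E, ‖f‖ ≤ 1 ∧ f v = ‖v‖ ∧ f w = 0 := by
  obtain ⟨g, hg, hgv⟩ := exists_dual_vector'' ℝ ((ℝ ∙ w).mkQ v)
  have hle (x : E) : ‖g ((ℝ ∙ w).mkQ x)‖ ≤ 1 * ‖x‖ :=
    (g.le_of_opNorm_le hg _).trans (by
      rw [one_mul, one_mul]; exact Submodule.Quotient.norm_mk_le (S := ℝ ∙ w) x)
  refine ⟨(g.toLinearMap ∘ₗ (ℝ ∙ w).mkQ).mkContinuous 1 hle,
    LinearMap.mkContinuous_norm_le _ zero_le_one _, ?_, ?_⟩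
  · change g ((ℝ ∙ w).mkQ v) = _
    rw [hgv, RCLike.ofReal_real_eq_id, id]
    refine le_antisymm (Submodule.Quotient.norm_mk_le (S := ℝ ∙ w) v) ?_
    refine QuotientAddGroup.le_norm_iff.2 fun m hm => ?_
    have : m - v ∈ ℝ ∙ w := (Submodule.Quotient.eq _).1 hm
    obtain ⟨s, hs⟩ := Submodule.mem_span_singleton.1 this
    have := h s
    rwa [hs, add_sub_cancel] at this
  · change g ((ℝ ∙ w).mkQ w) = _
    have : (ℝ ∙ w).mkQ w = 0 := by simp
    rw [this, map_zero]

theorem DifferentiableAt.bjPerp_iff {y w : E} (hy : DifferentiableAt ℝ (‖·‖) y) :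
    BJPerp y w ↔ fderiv ℝ (‖·‖) y w = 0 := by
  constructor
  · intro h
    have hline : HasDerivAt (fun s : ℝ => y + s • w) w 0 := by
      simpa using ((hasDerivAt_id (0 : ℝ)).smul_const w).const_add y
    have hy' : HasFDerivAt (‖·‖) (fderiv ℝ (‖·‖) y) (y + (0 : ℝ) • w) := by
      simpa using hy.hasFDerivAt
    have hmin : IsLocalMin (fun s : ℝ => ‖y + s • w‖) 0 :=
      Eventually.of_forall fun s => by simpa using h s
    exact hmin.hasDerivAt_eq_zero (hy'.comp_hasDerivAt (0 : ℝ) hline)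
  · exact bjPerp_of_dual _ (norm_fderiv_le_of_lipschitz (C := 1) ℝ lipschitzWith_one_norm)
      hy.fderiv_norm_self

theorem isClosed_setOf_bjPerp_left (u : E) : IsClosed {y : E | BJPerp y u} := by
  simp only [BJPerp, Set.ofPred_forall]
  exact isClosed_iInter fun s => isClosed_le (by fun_prop) (by fun_prop)

theorem isClosed_setOf_bjPerp_right (u : E) : IsClosed {y : E | BJPerp u y} := by
  simp only [BJPerp, Set.ofPred_forall]
  exact isClosed_iInter fun s => isClosed_le (by fun_prop) (by fun_prop)

theorem exists_ne_zero_of_two_functionals (hdim : 3 ≤ Module.finrank ℝ E) (f g : E →ₗ[ℝ] ℝ) :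
    ∃ z : E, z ≠ 0 ∧ f z = 0 ∧ g z = 0 := by
  have : FiniteDimensional ℝ E := Module.finite_of_finrank_pos (by omega)
  have hker : (f.prod g).ker ≠ ⊥ :=
    LinearMap.ker_ne_bot_of_finrank_lt (by simp; omega)
  obtain ⟨z, hz, hz0⟩ := Submodule.exists_mem_ne_zero_of_ne_bot hker
  obtain ⟨hfz, hgz⟩ := Prod.ext_iff.1 (LinearMap.mem_ker.1 hz)
  exact ⟨z, hz0, hfz, hgz⟩

theorem bjPerp_of_duals_opposite (hsymm : ∀ v w : E, BJPerp v w → BJPerp w v) {u h : E}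
    {f g : StrongDual ℝ E} (hf : ‖f‖ ≤ 1) (hfu : f u = ‖u‖) (hg : ‖g‖ ≤ 1) (hgu : g u = ‖u‖)
    (hfh : 0 < f h) (hgh : g h < 0) : BJPerp h u := by
  refine hsymm _ _ ?_
  have hd : 0 < f h - g h := by linarith
  set c := -g h / (f h - g h) with hc
  have hc0 : 0 ≤ c := div_nonneg (by linarith) hd.le
  have hc1 : 0 ≤ 1 - c := by
    rw [hc, sub_nonneg, div_le_one hd]; linarith
  refine bjPerp_of_dual (c • f + (1 - c) • g) ?_ ?_ ?_
  · refine (norm_add_le _ _).trans ?_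
    rw [norm_smul, norm_smul, Real.norm_of_nonneg hc0, Real.norm_of_nonneg hc1]
    nlinarith
  · simp only [add_apply, smul_apply, smul_eq_mul, hfu, hgu]
    ring
  · simp only [add_apply, smul_apply, smul_eq_mul, hc]
    field_simp
    ring

theorem norm_add_smul_eq_of_duals_opposite (hsymm : ∀ v w : E, BJPerp v w → BJPerp w v) {u h : E}
    {f g : StrongDual ℝ E} (hf : ‖f‖ ≤ 1) (hfu : f u = ‖u‖) (hg : ‖g‖ ≤ 1) (hgu : g u = ‖u‖)
    {t : ℝ} (hfh : 0 < f h) (hgh : g h < 0) (hfh' : 0 < f (h + t • u))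
    (hgh' : g (h + t • u) < 0) : ‖h + t • u‖ = ‖h‖ := by
  refine le_antisymm ?_ (bjPerp_of_duals_opposite hsymm hf hfu hg hgu hfh hgh t)
  simpa using bjPerp_of_duals_opposite hsymm hf hfu hg hgu hfh' hgh' (-t)

theorem bjPerp_of_differentiableAt (hsymm : ∀ v w : E, BJPerp v w → BJPerp w v) {u h y z : E}
    {f g : StrongDual ℝ E} (hu : u ≠ 0) (hf : ‖f‖ ≤ 1) (hfu : f u = ‖u‖) (hg : ‖g‖ ≤ 1)
    (hgu : g u = ‖u‖) (hfh : 0 < f h) (hgh : g h < 0) (hfz : f z = 0) (hgz : g z = 0)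
    (hy : DifferentiableAt ℝ (‖·‖) y) (hyz : ¬ BJPerp y z) : BJPerp y u := by
  rw [hy.bjPerp_iff] at hyz ⊢
  set D := fderiv ℝ (‖·‖) y
  set m := h - (D h / D z) • z with hm
  have hDm : D m = 0 := by simp [hm, hyz]
  have hfm : f m = f h := by simp [hm, hfz]
  have hgm : g m = g h := by simp [hm, hgz]
  have hmy : BJPerp m y := hsymm _ _ (hy.bjPerp_iff.2 hDm)
  have hun : 0 < ‖u‖ := norm_pos_iff.2 hu
  set t := -g h / (2 * ‖u‖) with ht
  have htu : t * ‖u‖ = -g h / 2 := by rw [ht]; field_simp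
  have ht0 : t ≠ 0 := (div_pos (by linarith) (by positivity)).ne'
  have hft : 0 < f (m + t • u) := by
    simp only [map_add, map_smul, smul_eq_mul, hfu, hfm, htu]
    linarith
  have hgt : g (m + t • u) < 0 := by
    simp only [map_add, map_smul, smul_eq_mul, hgu, hgm, htu]
    linarith
  have hperp : BJPerp (m + t • u) y := by
    refine bjPerp_of_eventually ?_
    have hpos (φ : StrongDual ℝ E) (x : E) (hx : 0 < φ x) : ∀ᶠ s : ℝ in 𝓝 0, 0 < φ (x + s • y) := by
      have : ContinuousAt (fun s : ℝ => φ (x + s • y)) 0 := by fun_prop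
      exact this.eventually (lt_mem_nhds (by simpa using hx))
    filter_upwards [hpos f m (by rwa [hfm]), hpos f _ hft, hpos (-g) m (by simpa [hgm] using hgh),
      hpos (-g) (m + t • u) (by rw [neg_apply]; linarith)] with s h1 h2 h3 h4
    rw [neg_apply, Left.neg_pos_iff] at h3 h4
    rw [add_right_comm] at h2 h4 ⊢
    rw [norm_add_smul_eq_of_duals_opposite hsymm hf hfu hg hgu (by rwa [hfm]) (by rwa [hgm]) hft hgt,
      norm_add_smul_eq_of_duals_opposite hsymm hf hfu hg hgu h1 h3 h2 h4]
    exact hmy s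
  have := hy.bjPerp_iff.1 (hsymm _ _ hperp)
  change D (m + t • u) = 0 at this
  rw [map_add, hDm, zero_add, map_smul, smul_eq_mul] at this
  exact (mul_eq_zero.1 this).resolve_left ht0

theorem not_forall_norm_add_smul_le {u z : E} (hu : u ≠ 0) (hz : z ≠ 0) :
    ¬ ∀ r : ℝ, ‖z + r • u‖ ≤ ‖z‖ := by
  intro h
  have hun : 0 < ‖u‖ := norm_pos_iff.2 hu
  have hzn : 0 < ‖z‖ := norm_pos_iff.2 hz
  have h1 := h (3 * ‖z‖ / ‖u‖)
  have h2 : ‖(3 * ‖z‖ / ‖u‖) • u‖ = 3 * ‖z‖ := by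
    rw [norm_smul_of_nonneg (by positivity)]; field_simp
  have h3 := norm_sub_le (z + (3 * ‖z‖ / ‖u‖) • u) z
  rw [add_sub_cancel_left, h2] at h3
  linarith

/-- In dimension at least three, symmetry of Birkhoff–James orthogonality forces smoothness. -/
theorem dual_unique_of_bjPerp_symm (hdim : 3 ≤ Module.finrank ℝ E)
    (hsymm : ∀ v w : E, BJPerp v w → BJPerp w v) {u : E} (hu : u ≠ 0) {f g : StrongDual ℝ E}
    (hf : ‖f‖ ≤ 1) (hfu : f u = ‖u‖) (hg : ‖g‖ ≤ 1) (hgu : g u = ‖u‖) : f = g := by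
  by_contra hfg
  have : FiniteDimensional ℝ E := Module.finite_of_finrank_pos (by omega)
  have hun : 0 < ‖u‖ := norm_pos_iff.2 hu
  obtain ⟨a, ha⟩ : ∃ a, g a < f a := by
    obtain ⟨a, ha⟩ := DFunLike.ne_iff.1 hfg
    rcases lt_or_gt_of_ne ha with h | h
    · exact ⟨-a, by simpa using h⟩
    · exact ⟨a, h⟩
  obtain ⟨h, hfh, hgh⟩ : ∃ h, 0 < f h ∧ g h < 0 := by
    refine ⟨a - ((f a + g a) / (2 * ‖u‖)) • u, ?_, ?_⟩ <;>
    · simp only [map_sub, map_smul, smul_eq_mul, hfu, hgu]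
      have : (f a + g a) / (2 * ‖u‖) * ‖u‖ = (f a + g a) / 2 := by field_simp
      linarith
  obtain ⟨z, hz, hfz, hgz⟩ := exists_ne_zero_of_two_functionals hdim f.toLinearMap g.toLinearMap
  have hperp (y : E) (hy : ¬ BJPerp z y) : BJPerp y u := by
    have hopen : IsOpen {y : E | BJPerp y z}ᶜ := (isClosed_setOf_bjPerp_left z).isOpen_compl
    have hsub := (dense_differentiableAt_norm (E := E)).open_subset_closure_inter hopen
    refine closure_minimal ?_ (isClosed_setOf_bjPerp_left u) (hsub fun h => hy (hsymm _ _ h))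
    rintro x ⟨hxz, hx⟩
    exact bjPerp_of_differentiableAt hsymm hu hf hfu hg hgu hfh hgh hfz hgz hx hxz
  have hlocal : ∀ᶠ r : ℝ in 𝓝 0, ‖z + r • u‖ ≤ ‖z‖ := by
    have hopen : IsOpen {y : E | BJPerp z y}ᶜ := (isClosed_setOf_bjPerp_right z).isOpen_compl
    have hcont : ContinuousAt (fun r : ℝ => z + r • u) 0 := by fun_prop
    have hmem : z + (0 : ℝ) • u ∈ {y : E | BJPerp z y}ᶜ := by
      intro h
      have := h (-1)
      simp [hz] at this
    filter_upwards [hcont (hopen.mem_nhds hmem)] with r hr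
    simpa using hperp _ hr (-r)
  refine not_forall_norm_add_smul_le hu hz fun r => ?_
  suffices ¬ BJPerp z (z + r • u) by simpa using hperp _ this (-r)
  intro hzr
  have hcont : Tendsto (fun ε : ℝ => -ε * r / (1 - ε)) (𝓝 0) (𝓝 0) := by
    have : ContinuousAt (fun ε : ℝ => -ε * r / (1 - ε)) 0 :=
      ContinuousAt.div (by fun_prop) (by fun_prop) (by simp)
    simpa [ContinuousAt] using this
  obtain ⟨ε, ⟨hε, hε1⟩, hε0⟩ := (((hcont.eventually hlocal).and (gt_mem_nhds one_pos)).filter_mono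
    nhdsWithin_le_nhds |>.and (self_mem_nhdsWithin (s := Set.Ioi (0 : ℝ)))).exists
  have hε0 : 0 < ε := hε0
  have hne : 1 - ε ≠ 0 := by linarith
  have heq : z + (-ε) • (z + r • u) = (1 - ε) • (z + (-ε * r / (1 - ε)) • u) := by
    rw [smul_add (1 - ε), smul_smul, mul_div_cancel₀ _ hne]
    module
  have := hzr (-ε)
  rw [heq, norm_smul_of_nonneg (by linarith)] at this
  have hzn : 0 < ‖z‖ := norm_pos_iff.2 hz
  nlinarith [mul_le_mul_of_nonneg_left hε (by linarith : 0 ≤ 1 - ε)]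

theorem exists_dual_map_of_bjPerp_symm (hdim : 3 ≤ Module.finrank ℝ E)
    (hsymm : ∀ v w : E, BJPerp v w → BJPerp w v) :
    ∃ F : E → E →ₗ[ℝ] ℝ, (∀ v, v ≠ 0 → F v v ≠ 0) ∧ ∀ v w, BJPerp v w ↔ F v w = 0 := by
  choose f hf hfv using fun v : E => exists_dual_vector'' ℝ v
  simp only [RCLike.ofReal_real_eq_id, id] at hfv
  refine ⟨fun v => ‖v‖ • (f v).toLinearMap, fun v hv => ?_, fun v w => ?_⟩
  · simp [hfv, hv]
  · rcases eq_or_ne v 0 with rfl | hv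
    · simp [BJPerp]
    · have : BJPerp v w ↔ f v w = 0 := by
        refine ⟨fun h => ?_, bjPerp_of_dual _ (hf v) (hfv v)⟩
        obtain ⟨g, hg, hgv, hgw⟩ := h.exists_dual
        rw [dual_unique_of_bjPerp_symm hdim hsymm hv (hf v) (hfv v) hg hgv, hgw]
      simp [this, hv]

end BirkhoffJames

section Polarity

variable {V : Type*} [AddCommGroup V] [Module ℝ V] {F : V → V →ₗ[ℝ] ℝ}

theorem polarity_ratio (hs : ∀ v w, F v w = 0 → F w v = 0) {d e r : V} (hd : F d r = 0)
    (he : F e r = 0) (x : V) (l : ℝ) :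
    F x e * F (l • x + r) d = F x d * F (l • x + r) e := by
  have h1 : F (F x e • d - F x d • e) x = 0 := hs _ _ (by simp [mul_comm])
  have h2 : F (F x e • d - F x d • e) r = 0 := hs _ _ (by simp [hs _ _ hd, hs _ _ he])
  have h3 := hs (F x e • d - F x d • e) (l • x + r) (by simp [h1, h2])
  simpa [sub_eq_zero] using h3

theorem eq_mul_of_map_add_of_map_mul {φ : ℝ → ℝ} (h1 : φ 1 ≠ 0)
    (hadd : ∀ s t, φ (s + t) = φ s + φ t) (hmul : ∀ s t, φ (s * t) * φ 1 = φ s * φ t) (t : ℝ) :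
    φ t = φ 1 * t := by
  have h0 : φ 0 = 0 := by simpa using hadd 0 0
  let m : ℝ →+* ℝ :=
    { toFun := fun t => φ t / φ 1
      map_one' := div_self h1
      map_mul' := fun s t => by
        rw [div_mul_div_comm, ← hmul]
        field_simp
      map_zero' := by simp [h0]
      map_add' := fun s t => by rw [hadd, add_div] }
  have hm : m t = t := by rw [Subsingleton.elim m (RingHom.id ℝ), RingHom.id_apply]
  change φ t / φ 1 = t at hm
  field_simp at hm
  exact hm

/-- A symmetric polarity without self-conjugate points, in dimension at least three, is given on
the span of two conjugate vectors by a positive definite quadratic form. -/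
theorem exists_pos_of_polarity (hs : ∀ v w, F v w = 0 → F w v = 0) (hF : ∀ v, v ≠ 0 → F v v ≠ 0)
    {e₁ e₂ e₃ : V} (h₁ : e₁ ≠ 0) (h₂ : e₂ ≠ 0) (h₃ : e₃ ≠ 0) (h₁₂ : F e₁ e₂ = 0)
    (h₁₃ : F e₁ e₃ = 0) (h₂₃ : F e₂ e₃ = 0) :
    ∃ c : ℝ, 0 < c ∧ ∀ a b a' b' : ℝ, a * a' + c * (b * b') = 0 →
      F (a • e₁ + b • e₂) (a' • e₁ + b' • e₂) = 0 := by
  have h₂₁ := hs _ _ h₁₂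
  have h₃₁ := hs _ _ h₁₃
  have h₃₂ := hs _ _ h₂₃
  have hsi (v w) : F v w = 0 ↔ F w v = 0 := ⟨hs _ _, hs _ _⟩
  have z₁ (a b c : ℝ) : F (a • e₁ + b • e₂ + c • e₃) e₁ = 0 ↔ a = 0 := by
    rw [hsi]; simp [h₁₂, h₁₃, hF _ h₁]
  have z₂ (a b c : ℝ) : F (a • e₁ + b • e₂ + c • e₃) e₂ = 0 ↔ b = 0 := by
    rw [hsi]; simp [h₂₁, h₂₃, hF _ h₂]
  have z₃ (a b c : ℝ) : F (a • e₁ + b • e₂ + c • e₃) e₃ = 0 ↔ c = 0 := by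
    rw [hsi]; simp [h₃₁, h₃₂, hF _ h₃]
  set φ : ℝ → ℝ := fun t => F (e₁ + t • e₂) e₂ / F (e₁ + t • e₂) e₁ with hφ
  set ψ : ℝ → ℝ := fun t => F (e₁ + t • e₃) e₃ / F (e₁ + t • e₃) e₁ with hψ
  set χ : ℝ → ℝ := fun t => F (e₂ + t • e₃) e₃ / F (e₂ + t • e₃) e₂ with hχ
  have n₁₂ (t : ℝ) : F (e₁ + t • e₂) e₁ ≠ 0 := by simpa using (z₁ 1 t 0).not
  have n₁₃ (t : ℝ) : F (e₁ + t • e₃) e₁ ≠ 0 := by simpa using (z₁ 1 0 t).not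
  have n₂₃ (t : ℝ) : F (e₂ + t • e₃) e₂ ≠ 0 := by simpa using (z₂ 0 1 t).not
  have Aφ (a t s : ℝ) : F (a • (e₁ + t • e₂) + s • e₃) e₂ =
      φ t * F (a • (e₁ + t • e₂) + s • e₃) e₁ := by
    rw [hφ, div_mul_eq_mul_div, eq_div_iff (n₁₂ t), mul_comm]
    exact (polarity_ratio hs (by simp [h₁₃]) (by simp [h₂₃]) _ _).symm
  have Aψ (t s : ℝ) : F (e₁ + t • e₂ + s • e₃) e₃ = ψ s * F (e₁ + t • e₂ + s • e₃) e₁ := by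
    rw [hψ, div_mul_eq_mul_div, eq_div_iff (n₁₃ s), mul_comm]
    have := (polarity_ratio hs (d := e₁) (e := e₃) (r := t • e₂) (by simp [h₁₂]) (by simp [h₃₂])
      (e₁ + s • e₃) 1).symm
    rwa [one_smul, add_right_comm] at this
  have Aχ (t s : ℝ) (ht : t ≠ 0) : F (e₁ + t • e₂ + s • e₃) e₃ =
      χ (s / t) * F (e₁ + t • e₂ + s • e₃) e₂ := by
    rw [hχ, div_mul_eq_mul_div, eq_div_iff (n₂₃ _), mul_comm]
    have := (polarity_ratio hs (d := e₂) (e := e₃) (r := e₁) h₂₁ h₃₁ (e₂ + (s / t) • e₃) t).symm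
    rwa [smul_add, smul_smul, mul_div_cancel₀ _ ht, add_comm (t • e₂ + s • e₃),
      ← add_assoc] at this
  have φ0 : φ 0 = 0 := by simp [hφ, h₁₂]
  have χ0 : χ 0 = 0 := by simp [hχ, h₂₃]
  have φ1 : φ 1 ≠ 0 := div_ne_zero (by simpa using (z₂ 1 1 0).not) (n₁₂ 1)
  have χ1 : χ 1 ≠ 0 := div_ne_zero (by simpa using (z₃ 0 1 1).not) (n₂₃ 1)
  have n₁ (t s : ℝ) : F (e₁ + t • e₂ + s • e₃) e₁ ≠ 0 := by simpa using (z₁ 1 t s).not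
  have Aφ' (t s : ℝ) := by simpa only [one_smul] using Aφ 1 t s
  have hψχ (t s : ℝ) (ht : t ≠ 0) : ψ s = χ (s / t) * φ t := by
    refine mul_right_cancel₀ (n₁ t s) ?_
    rw [← Aψ, Aχ t s ht, Aφ', mul_assoc]
  have hψ1 (s : ℝ) : ψ s = χ s * φ 1 := by simpa using hψχ 1 s one_ne_zero
  have hχφ (t : ℝ) : χ t * φ 1 = χ 1 * φ t := by
    rcases eq_or_ne t 0 with rfl | ht
    · simp [φ0, χ0]
    · rw [← hψ1, hψχ t t ht, div_self ht]
  have hmul (s t : ℝ) : φ (s * t) * φ 1 = φ s * φ t := by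
    rcases eq_or_ne s 0 with rfl | hs0
    · simp [φ0]
    · have h1 : χ (s * t) * φ 1 = χ t * φ s := by
        rw [← hψ1, hψχ s (s * t) hs0, mul_div_cancel_left₀ _ hs0]
      refine mul_left_cancel₀ χ1 ?_
      linear_combination φ 1 * h1 - φ 1 * hχφ (s * t) + φ s * hχφ t
  have hadd (s t : ℝ) : φ (s + t) = φ s + φ t := by
    set y := φ s • e₁ - e₂ + (χ 1)⁻¹ • e₃ with hy
    have hy1 : F y (e₁ + s • e₂) = 0 := by
      have h2 : F (e₁ + s • e₂) e₂ = φ s * F (e₁ + s • e₂) e₁ := by simpa using Aφ' s 0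
      have h3 : F (e₁ + s • e₂) e₃ = 0 := by simpa using (z₃ 1 s 0)
      refine hs _ _ ?_
      simp [hy, h2, h3]
    have hy2 : F y (e₂ + e₃) = 0 := by
      have h1 : F (e₂ + e₃) e₁ = 0 := by simpa using (z₁ 0 1 1)
      have h3 : F (e₂ + e₃) e₃ = χ 1 * F (e₂ + e₃) e₂ := by
        have := n₂₃ 1
        simp only [one_smul] at this
        simp [hχ, this]
      refine hs _ _ ?_
      simp [hy, h1, h3, χ1]
    have hy3 : F (e₁ + (s + t) • e₂ + t • e₃) y = 0 := by
      refine hs _ _ ?_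
      rw [show e₁ + (s + t) • e₂ + t • e₃ = e₁ + s • e₂ + t • (e₂ + e₃) by module]
      rw [map_add, map_smul, hy1, hy2, smul_zero, add_zero]
    have hn := n₁ (s + t) t
    simp only [hy, map_add, map_sub, map_smul, smul_eq_mul, Aφ', Aψ] at hy3
    have h4 : ψ t = χ 1 * φ t := by rw [hψ1, hχφ]
    rw [h4] at hy3
    field_simp at hy3
    have := (mul_eq_zero.1 hy3).resolve_left hn
    linarith
  have hlin := eq_mul_of_map_add_of_map_mul φ1 hadd hmul
  have hconj (a b a' b' : ℝ) (h : a * a' + φ 1 * (b * b') = 0) :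
      F (a • e₁ + b • e₂) (a' • e₁ + b' • e₂) = 0 := by
    simp only [map_add, map_smul, smul_eq_mul]
    rcases eq_or_ne a 0 with rfl | ha
    · have h1 : F ((0 : ℝ) • e₁ + b • e₂) e₁ = 0 := by simpa using z₁ 0 b 0
      have h2 : F ((0 : ℝ) • e₁ + b • e₂) e₂ = 0 ↔ b = 0 := by simpa using z₂ 0 b 0
      have : b = 0 ∨ b' = 0 := by simpa [φ1] using h
      rcases this with hb | hb
      · rw [h1, h2.2 hb]; ring
      · rw [h1, hb]; ring
    · have h2 := Aφ a (b / a) 0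
      rw [zero_smul, add_zero, smul_add, smul_smul, mul_div_cancel₀ _ ha, hlin] at h2
      rw [h2]
      field_simp
      linear_combination F (a • e₁ + b • e₂) e₁ * h
  refine ⟨φ 1, ?_, hconj⟩
  by_contra hneg
  have hneg : 0 < -φ 1 := by
    have := lt_of_le_of_ne (not_lt.1 hneg) φ1
    linarith
  set t := (√(-φ 1))⁻¹ with ht
  have htt : t * t = (-φ 1)⁻¹ := by rw [ht, ← mul_inv, Real.mul_self_sqrt hneg.le]
  have := hconj 1 t 1 t (by rw [htt]; field_simp; ring)
  refine hF _ ?_ this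
  intro h0
  have := n₁₂ t
  rw [one_smul] at h0
  rw [h0] at this
  exact this ((hsi _ _).2 (map_zero _))

end Polarity

section Rotation

variable {E : Type*} [NormedAddCommGroup E] [NormedSpace ℝ E]

theorem norm_cos_add_sin_eq {p q : E}
    (h : ∀ a b a' b' : ℝ, a * a' + b * b' = 0 → BJPerp (a • p + b • q) (a' • p + b' • q)) (θ : ℝ) :
    ‖Real.cos θ • p + Real.sin θ • q‖ = ‖p‖ := by
  set g : ℝ → ℝ := fun θ => ‖Real.cos θ • p + Real.sin θ • q‖ with hg
  have hcos (a b : ℝ) : Real.cos (b - a) * g a ≤ g b := by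
    have hperp := h (Real.cos (b - a) * Real.cos a) (Real.cos (b - a) * Real.sin a)
      (-(Real.sin (b - a) * Real.sin a)) (Real.sin (b - a) * Real.cos a) (by ring) 1
    have h1 : (Real.cos (b - a) * Real.cos a) • p + (Real.cos (b - a) * Real.sin a) • q =
        Real.cos (b - a) • (Real.cos a • p + Real.sin a • q) := by module
    have h2 : (Real.cos (b - a) * Real.cos a) • p + (Real.cos (b - a) * Real.sin a) • q +
        (1 : ℝ) • (-(Real.sin (b - a) * Real.sin a) • p + (Real.sin (b - a) * Real.cos a) • q) =
        Real.cos b • p + Real.sin b • q := by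
      have hb : b = (b - a) + a := by ring
      nth_rewrite 5 [hb]
      nth_rewrite 6 [hb]
      rw [Real.cos_add, Real.sin_add]
      module
    rw [h2, h1, norm_smul] at hperp
    exact (mul_le_mul_of_nonneg_right (le_abs_self _) (norm_nonneg _)).trans hperp
  have hbound (a : ℝ) : g a ≤ ‖p‖ + ‖q‖ := by
    refine (norm_add_le _ _).trans (add_le_add ?_ ?_) <;> rw [norm_smul]
    · exact mul_le_of_le_one_left (norm_nonneg _) (Real.abs_cos_le_one a)
    · exact mul_le_of_le_one_left (norm_nonneg _) (Real.abs_sin_le_one a)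
  have hsq (a b : ℝ) : g a - g b ≤ (‖p‖ + ‖q‖) * (b - a) ^ 2 := by
    have h1 := Real.one_sub_sq_div_two_le_cos (x := b - a)
    have h2 : 0 ≤ g a := norm_nonneg _
    have h3 := hbound a
    nlinarith [hcos a b, mul_le_mul_of_nonneg_right h1 h2,
      mul_le_mul_of_nonneg_right h3 (sq_nonneg (b - a)), mul_nonneg h2 (sq_nonneg (b - a))]
  have hderiv (a : ℝ) : HasDerivAt g 0 a := by
    have hO : (fun b => g b - g a) =O[𝓝 a] fun b => ‖b - a‖ ^ 2 := by
      refine Asymptotics.IsBigO.of_bound (‖p‖ + ‖q‖) (Eventually.of_forall fun b => ?_)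
      rw [Real.norm_eq_abs, norm_pow, norm_norm, Real.norm_eq_abs, sq_abs, abs_le]
      have h1 := hsq a b
      have h2 := hsq b a
      constructor <;> nlinarith
    have := (hO.hasFDerivAt (𝕜 := ℝ) one_lt_two).hasDerivAt.add_const (g a)
    simpa using this
  have := is_const_of_deriv_eq_zero (fun a => (hderiv a).differentiableAt)
    (fun a => (hderiv a).deriv) θ 0
  simpa [hg] using this

theorem norm_sq_smul_add_smul {p q : E} {c : ℝ} (hc : 0 < c)
    (h : ∀ a b a' b' : ℝ, a * a' + c * (b * b') = 0 → BJPerp (a • p + b • q) (a' • p + b' • q))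
    (a b : ℝ) : ‖a • p + b • q‖ ^ 2 = ‖p‖ ^ 2 * (a ^ 2 + c * b ^ 2) := by
  have hsc : 0 < √c := Real.sqrt_pos.2 hc
  have hmul : √c * √c = c := Real.mul_self_sqrt hc.le
  have hrot := norm_cos_add_sin_eq (p := p) (q := (√c)⁻¹ • q) (fun a b a' b' hab => by
    simp only [smul_smul]
    refine h _ _ _ _ ?_
    rw [← hab]
    nth_rewrite 1 [← hmul]
    field_simp)
  set z : ℂ := ⟨a, √c * b⟩ with hz
  have hre : ‖z‖ * Real.cos z.arg = a := Complex.norm_mul_cos_arg z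
  have him : ‖z‖ * Real.sin z.arg = √c * b := Complex.norm_mul_sin_arg z
  have heq : a • p + b • q = ‖z‖ • (Real.cos z.arg • p + Real.sin z.arg • (√c)⁻¹ • q) := by
    rw [smul_add, smul_smul, smul_smul, hre, him, smul_smul]
    congr 2
    field_simp
  rw [heq, norm_smul, hrot, norm_norm, mul_pow, Complex.sq_norm, Complex.normSq_apply, hz]
  linear_combination b ^ 2 * ‖p‖ ^ 2 * hmul

theorem parallelogram_of_bjPerp_symm (hdim : 3 ≤ Module.finrank ℝ E)
    (hsymm : ∀ v w : E, BJPerp v w → BJPerp w v) (p q : E) :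
    ‖p + q‖ * ‖p + q‖ + ‖p - q‖ * ‖p - q‖ = 2 * (‖p‖ * ‖p‖ + ‖q‖ * ‖q‖) := by
  rcases eq_or_ne p 0 with rfl | hp
  · simp [two_mul]
  obtain ⟨F, hF, hperp⟩ := exists_dual_map_of_bjPerp_symm hdim hsymm
  obtain ⟨e, he, hpe, α, β, hq⟩ : ∃ e : E, e ≠ 0 ∧ F p e = 0 ∧ ∃ α β : ℝ, q = α • p + β • e := by
    rcases eq_or_ne (q - (F p q / F p p) • p) 0 with h0 | h0
    · obtain ⟨e, he, hpe, -⟩ := exists_ne_zero_of_two_functionals hdim (F p) (F p)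
      exact ⟨e, he, hpe, F p q / F p p, 0, by rw [zero_smul, add_zero]; exact sub_eq_zero.1 h0⟩
    · exact ⟨_, h0, by simp [hF p hp], F p q / F p p, 1, by module⟩
  obtain ⟨e', he', hpe', hee'⟩ := exists_ne_zero_of_two_functionals hdim (F p) (F e)
  obtain ⟨c, hc, hconj⟩ := exists_pos_of_polarity
    (fun v w h => (hperp _ _).1 (hsymm _ _ ((hperp _ _).2 h))) hF hp he he' hpe hpe' hee'
  have hnorm := norm_sq_smul_add_smul hc fun a b a' b' h => (hperp _ _).2 (hconj a b a' b' h)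
  have h1 : p + q = (1 + α) • p + β • e := by rw [hq]; module
  have h2 : p - q = (1 - α) • p + (-β) • e := by rw [hq]; module
  simp only [← sq]
  rw [h1, h2, hq, hnorm, hnorm, hnorm]
  ring

end Rotation

theorem bPerp_iff_inner_nonneg {E : Type*} [NormedAddCommGroup E] [InnerProductSpace ℝ E]
    {v w : E} : BPerp v w ↔ 0 ≤ inner ℝ v w := by
  have hexp (s : ℝ) : ‖v + s • w‖ ^ 2 = ‖v‖ ^ 2 + s * (2 * inner ℝ v w + s * ‖w‖ ^ 2) := by
    rw [norm_add_sq_real, inner_smul_right, norm_smul, mul_pow, Real.norm_eq_abs, sq_abs]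
    ring
  constructor
  · intro h
    by_contra! hneg
    have hw : 0 < ‖w‖ ^ 2 := by
      have : w ≠ 0 := by rintro rfl; simp at hneg
      positivity
    set s := -inner ℝ v w / ‖w‖ ^ 2 with hs
    have hs0 : 0 < s := div_pos (by linarith) hw
    have h1 := pow_le_pow_left₀ (norm_nonneg _) (h s hs0.le) 2
    have h2 : s * ‖w‖ ^ 2 = -inner ℝ v w := div_mul_cancel₀ _ hw.ne'
    rw [hexp, h2] at h1
    nlinarith
  · intro h s hs
    refine pow_le_pow_iff_left₀ (norm_nonneg _) (norm_nonneg _) two_ne_zero |>.1 ?_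
    rw [hexp]
    have : 0 ≤ s * (2 * inner ℝ v w + s * ‖w‖ ^ 2) := by positivity
    linarith

/-- Birkhoff–James: a real normed space of dimension ≥ 3 has symmetric Birkhoff
orthogonality iff its norm comes from an inner product (equivalently, the
parallelogram identity holds, i.e. the space is `InnerProductSpaceable`). -/
theorem stmt17 {E : Type*} [NormedAddCommGroup E] [NormedSpace ℝ E]
    (hdim : 3 ≤ Module.finrank ℝ E) :
    (∀ v w : E, BPerp v w → BPerp w v) ↔ InnerProductSpaceable E := by
  constructor
  · intro h
    exact ⟨parallelogram_of_bjPerp_symm hdim fun v w => bjPerp_symm h⟩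
  · intro h v w
    let I : InnerProductSpace ℝ E := InnerProductSpace.ofNorm ℝ h.parallelogram_identity
    intro hvw
    have hwv : 0 ≤ I.inner w v := by
      rw [real_inner_comm]
      exact (bPerp_iff_inner_nonneg (E := E)).1 hvw
    exact (bPerp_iff_inner_nonneg (E := E)).2 hwv
end
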